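/- For every w ≥ 0 and every y ∈ ℝ, the soft-thresholded value s_w(y) is the unique minimizer over ℝ of the function x ↦ (1/2)(x − y)² + w·|x|; that is, for every x ∈ ℝ with x ≠ s_w(y), one has (1/2)(s_w(y) − y)² + w·|s_w(y)| < (1/2)(x − y)² + w·|x|. -/

import Mathlib

/-- The soft-thresholding function `s_w`. -/
noncomputable def softThreshold (w y : ℝ) : ℝ :=
  if y < -w then y + w else if y ≤ w then 0 else y - w

/-- The residual `y - s_w(y)` is at most `w` in absolute value. -/
theorem abs_sub_softThreshold_le {w : ℝ} (hw : 0 ≤ w) (y : ℝ) :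
    |y - softThreshold w y| ≤ w := by
  unfold softThreshold
  rw [abs_le]
  split_ifs <;> constructor <;> linarith

/-- The residual `y - s_w(y)` is aligned with `s_w(y)`. -/
theorem sub_softThreshold_mul_softThreshold (w y : ℝ) :
    (y - softThreshold w y) * softThreshold w y = w * |softThreshold w y| := by
  unfold softThreshold
  split_ifs with h₁ h₂
  · rw [abs_of_neg (by linarith)]
    ring
  · simp
  · rw [abs_of_nonneg (by linarith)]
    ring

/-- `s_w(y)` is the unique minimizer of `x ↦ (1/2)(x−y)² + w|x|`. -/
theorem softThreshold_unique_minimizer (w : ℝ) (hw : 0 ≤ w) (y : ℝ) :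
    ∀ x : ℝ, x ≠ softThreshold w y →
      (1 / 2) * (softThreshold w y - y) ^ 2 + w * |softThreshold w y|
        < (1 / 2) * (x - y) ^ 2 + w * |x| := by
  intro x hx
  have h_align := sub_softThreshold_mul_softThreshold w y
  have h_subgradient : (y - softThreshold w y) * x ≤ w * |x| :=
    calc (y - softThreshold w y) * x ≤ |y - softThreshold w y| * |x| := by
          rw [← abs_mul]
          exact le_abs_self _
      _ ≤ w * |x| :=
          mul_le_mul_of_nonneg_right (abs_sub_softThreshold_le hw y) (abs_nonneg x)
  have h_sq : 0 < (x - softThreshold w y) ^ 2 := sq_pos_of_ne_zero (sub_ne_zero.mpr hx)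
  linarith
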